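/- For every e ∈ [0,1), the curve q_e : ℝ → ℝ² is C^∞ and 2π-periodic, satisfies ‖q_e(t)‖ = ρ(e,t) ≥ 1 − e > 0 for all t, and solves the Kepler equation of motion q̈_e(t) = −q_e(t)/‖q_e(t)‖³ for all t ∈ ℝ. Moreover its energy and angular momentum are constant: ‖q̇_e(t)‖²/2 − 1/‖q_e(t)‖ = −1/2 and q_{e,1}(t)·q̇_{e,2}(t) − q_{e,2}(t)·q̇_{e,1}(t) = √(1−e²) for all t. -/

import Mathlib

/-- First component of the Kepler elliptical motion of eccentricity `e`,
semi-major axis `1` and period `2π`: `q_{e,1}(t) = cos(u(e,t)) − e`. -/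
noncomputable def kq1 (U : ℝ → ℝ → ℝ) (e t : ℝ) : ℝ := Real.cos (U e t) - e

/-- Second component: `q_{e,2}(t) = √(1−e²)·sin(u(e,t))`. -/
noncomputable def kq2 (U : ℝ → ℝ → ℝ) (e t : ℝ) : ℝ :=
  Real.sqrt (1 - e ^ 2) * Real.sin (U e t)

section helpers

variable {v : ℝ → ℝ} {e : ℝ}

theorem kep_pos (h0 : 0 ≤ e) (h1 : e < 1) (x : ℝ) : 0 < 1 - e * Real.cos x := by
  nlinarith [Real.cos_le_one x]

theorem kep_lip (h0 : 0 ≤ e) (x y : ℝ) :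
    (1 - e) * |x - y| ≤ |(x - e * Real.sin x) - (y - e * Real.sin y)| := by
  have h := Real.lipschitzWith_sin.dist_le_mul x y
  simp only [Real.dist_eq, NNReal.coe_one, one_mul] at h
  have h2 : |x - y| ≤ |(x - e * Real.sin x) - (y - e * Real.sin y)|
      + |e * (Real.sin x - Real.sin y)| := by
    refine le_trans (le_of_eq ?_) (abs_add_le _ _)
    congr 1
    ring
  rw [abs_mul, abs_of_nonneg h0] at h2
  nlinarith

theorem kep_inj (h0 : 0 ≤ e) (h1 : e < 1) (x y : ℝ)
    (h : x - e * Real.sin x = y - e * Real.sin y) : x = y := by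
  have h2 := kep_lip h0 x y
  rw [h, sub_self, abs_zero] at h2
  have h3 : |x - y| ≤ 0 := by
    by_contra h4
    push Not at h4
    nlinarith
  exact sub_eq_zero.mp (abs_nonpos_iff.mp h3)

theorem kep_cont (h0 : 0 ≤ e) (h1 : e < 1)
    (hv : ∀ t, v t - e * Real.sin (v t) = t) : Continuous v := by
  have : LipschitzWith (Real.toNNReal (1 / (1 - e))) v := by
    refine LipschitzWith.of_dist_le_mul fun a b => ?_
    have h := kep_lip h0 (v a) (v b)
    rw [hv, hv] at h
    have h2 : 0 < 1 - e := by linarith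
    rw [Real.coe_toNNReal _ (by positivity), Real.dist_eq, Real.dist_eq, one_div,
      inv_mul_eq_div, le_div_iff₀ h2]
    linarith
  exact this.continuous

theorem kep_deriv (h0 : 0 ≤ e) (h1 : e < 1)
    (hv : ∀ t, v t - e * Real.sin (v t) = t) (t : ℝ) :
    HasDerivAt v (1 - e * Real.cos (v t))⁻¹ t := by
  have hf : HasDerivAt (fun x => x - e * Real.sin x) (1 - e * Real.cos (v t)) (v t) :=
    (hasDerivAt_id' _).sub ((Real.hasDerivAt_sin _).const_mul e)
  exact hf.of_local_left_inverse (kep_cont h0 h1 hv).continuousAt (kep_pos h0 h1 _).ne'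
    (Filter.Eventually.of_forall hv)

theorem kep_smooth (h0 : 0 ≤ e) (h1 : e < 1)
    (hv : ∀ t, v t - e * Real.sin (v t) = t) : ContDiff ℝ (⊤ : ℕ∞) v := by
  rw [contDiff_infty]
  intro n
  induction n with
  | zero => exact_mod_cast contDiff_zero.mpr (kep_cont h0 h1 hv)
  | succ n ih =>
    push_cast
    rw [contDiff_succ_iff_deriv]
    refine ⟨fun t => (kep_deriv h0 h1 hv t).differentiableAt, by simp, ?_⟩
    have : deriv v = fun t => (1 - e * Real.cos (v t))⁻¹ :=
      funext fun t => (kep_deriv h0 h1 hv t).deriv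
    rw [this]
    exact (contDiff_const.sub (contDiff_const.mul ih.cos)).inv
      fun t => (kep_pos h0 h1 _).ne'

end helpers

/-- For every `e ∈ [0,1)`, the curve `q_e : ℝ → ℝ²` is `C^∞`
and `2π`-periodic, satisfies `‖q_e(t)‖ = ρ(e,t) ≥ 1 − e > 0`, solves the Kepler
equation of motion `q̈ = −q/‖q‖³`, and has constant energy `−1/2` and constant
angular momentum `√(1−e²)`. -/
theorem stmt_9 (U : ℝ → ℝ → ℝ)
    (hU : ∀ e ∈ Set.Ico (0:ℝ) 1, ∀ ℓ : ℝ, U e ℓ - e * Real.sin (U e ℓ) = ℓ)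
    (e : ℝ) (he : e ∈ Set.Ico (0:ℝ) 1) :
    ContDiff ℝ (⊤ : ℕ∞) (kq1 U e) ∧ ContDiff ℝ (⊤ : ℕ∞) (kq2 U e) ∧
    Function.Periodic (kq1 U e) (2 * Real.pi) ∧
    Function.Periodic (kq2 U e) (2 * Real.pi) ∧
    (∀ t : ℝ, Real.sqrt (kq1 U e t ^ 2 + kq2 U e t ^ 2)
      = 1 - e * Real.cos (U e t)) ∧
    (∀ t : ℝ, 1 - e ≤ 1 - e * Real.cos (U e t)) ∧ 0 < 1 - e ∧
    (∀ t : ℝ,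
      deriv (deriv (kq1 U e)) t
        = -(kq1 U e t) / Real.sqrt (kq1 U e t ^ 2 + kq2 U e t ^ 2) ^ 3 ∧
      deriv (deriv (kq2 U e)) t
        = -(kq2 U e t) / Real.sqrt (kq1 U e t ^ 2 + kq2 U e t ^ 2) ^ 3) ∧
    (∀ t : ℝ,
      (deriv (kq1 U e) t ^ 2 + deriv (kq2 U e) t ^ 2) / 2
        - 1 / Real.sqrt (kq1 U e t ^ 2 + kq2 U e t ^ 2) = -(1 / 2)) ∧
    (∀ t : ℝ,
      kq1 U e t * deriv (kq2 U e) t - kq2 U e t * deriv (kq1 U e) t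
        = Real.sqrt (1 - e ^ 2)) := by
  obtain ⟨h0, h1⟩ := he
  have hv := hU e ⟨h0, h1⟩
  have hpos := fun t => kep_pos h0 h1 (U e t)
  have hd := kep_deriv h0 h1 hv
  have hs := kep_smooth h0 h1 hv
  have hper : ∀ t, U e (t + 2 * Real.pi) = U e t + 2 * Real.pi := by
    intro t
    apply kep_inj h0 h1
    rw [hv, Real.sin_add_two_pi]
    linarith [hv t]
  have hb : 0 ≤ 1 - e ^ 2 := by nlinarith
  have hb2 := Real.sq_sqrt hb
  have hnorm : ∀ t : ℝ, Real.sqrt (kq1 U e t ^ 2 + kq2 U e t ^ 2)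
      = 1 - e * Real.cos (U e t) := by
    intro t
    rw [Real.sqrt_eq_iff_mul_self_eq (by positivity) (hpos t).le]
    simp only [kq1, kq2, mul_pow, hb2, Real.sin_sq]
    ring
  have hd1 : ∀ t, HasDerivAt (kq1 U e)
      (-Real.sin (U e t) * (1 - e * Real.cos (U e t))⁻¹) t := fun t =>
    (hd t).cos.sub_const e
  have hd2 : ∀ t, HasDerivAt (kq2 U e)
      (Real.sqrt (1 - e ^ 2) * (Real.cos (U e t) * (1 - e * Real.cos (U e t))⁻¹)) t := fun t =>
    (hd t).sin.const_mul _
  have hD1 := funext fun t => (hd1 t).deriv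
  have hD2 := funext fun t => (hd2 t).deriv
  have hi : ∀ t, HasDerivAt (fun t => (1 - e * Real.cos (U e t))⁻¹) _ t := fun t =>
    (((hd t).cos.const_mul e).const_sub 1).inv (hpos t).ne'
  refine ⟨hs.cos.sub contDiff_const, contDiff_const.mul hs.sin, ?_, ?_, hnorm, ?_,
    by linarith, ?_, ?_, ?_⟩
  · intro t
    simp only [kq1, hper, Real.cos_add_two_pi]
  · intro t
    simp only [kq2, hper, Real.sin_add_two_pi]
  · intro t
    nlinarith [Real.cos_le_one (U e t)]
  · intro t
    have hp := (hpos t).ne'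
    rw [hnorm, hD1, hD2, ((hd t).sin.fun_neg.fun_mul (hi t)).deriv,
      (((hd t).cos.fun_mul (hi t)).const_mul _).deriv]
    simp only [kq1, kq2]
    have hsc := Real.sin_sq (U e t)
    generalize Real.sin (U e t) = s at *
    generalize Real.cos (U e t) = c at *
    constructor
    · field_simp
      ring_nf
      rw [hsc]
      ring
    · field_simp
      ring
  · intro t
    have hp := (hpos t).ne'
    rw [hnorm, hD1, hD2]
    simp only [mul_pow, hb2, neg_sq, Real.sin_sq]
    generalize Real.cos (U e t) = c at *
    have hw := mul_inv_cancel₀ hp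
    rw [one_div]
    generalize (1 - e * c)⁻¹ = w at *
    linear_combination ((1 + e * c) * w / 2 - 1 / 2) * hw
  · intro t
    have hp := (hpos t).ne'
    rw [hD1, hD2]
    simp only [kq1, kq2]
    have hsc := Real.sin_sq (U e t)
    generalize Real.sin (U e t) = s at *
    generalize Real.cos (U e t) = c at *
    have hw := mul_inv_cancel₀ hp
    generalize (1 - e * c)⁻¹ = w at *
    linear_combination Real.sqrt (1 - e ^ 2) * hw + Real.sqrt (1 - e ^ 2) * w * hsc
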